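/- arXiv:2605.19475 — 7 statements merged into one kernel-verified Lean document; each statement's English description precedes it below -/
import Mathlib

section
/- Let a, c ∈ ℂ and N ∈ ℕ. Define the operators V, X, Z on functions f : ℂ → ℂ by (Vf)(x) = (x+a)(x+1−a−N)·f(x+1) − x(x+1)·f(x), (Xf)(x) = x·f(x−1) − (x+c)·f(x), and (Zf)(x) = −f(x−1). Then for every function f : ℂ → ℂ and every x ∈ ℂ, (V(Zf))(x) − (Z(Vf))(x) = 2·(Xf)(x) + (2c+N)·f(x); that is, the commutator [V,Z] equals 2X + η·I with η = 2c+N. -/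
/-- The difference operator `V` of the Hahn realization. -/
noncomputable def Vop (a : ℂ) (N : ℕ) (f : ℂ → ℂ) : ℂ → ℂ :=
  fun x => (x + a) * (x + 1 - a - N) * f (x + 1) - x * (x + 1) * f x

/-- The difference operator `X` of the Hahn realization. -/
noncomputable def Xop (c : ℂ) (f : ℂ → ℂ) : ℂ → ℂ :=
  fun x => x * f (x - 1) - (x + c) * f x

/-- The difference operator `Z` of the Hahn realization. -/
noncomputable def Zop (f : ℂ → ℂ) : ℂ → ℂ :=
  fun x => -f (x - 1)

/-- `[V, Z] = 2 X + η I` with `η = 2c + N`. -/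
theorem commutator_V_Z (a c : ℂ) (N : ℕ) (f : ℂ → ℂ) (x : ℂ) :
    Vop a N (Zop f) x - Zop (Vop a N f) x = 2 * Xop c f x + (2 * c + N) * f x := by
  simp only [Vop, Xop, Zop, add_sub_cancel_right, sub_add_cancel]
  ring
end

section
/- Let a, c ∈ ℂ and N ∈ ℕ. Define the operators V, X, Z on functions f : ℂ → ℂ by (Vf)(x) = (x+a)(x+1−a−N)·f(x+1) − x(x+1)·f(x), (Xf)(x) = x·f(x−1) − (x+c)·f(x), and (Zf)(x) = −f(x−1). Then for every function f : ℂ → ℂ and every x ∈ ℂ, (X(Vf))(x) − (V(Xf))(x) = (V(Zf))(x) + (Z(Vf))(x) + (Vf)(x) + (1−a)(a+N)·f(x); that is, [X,V] = {V,Z} + V + ξ·I with ξ = (1−a)(a+N). -/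
/-- `[X, V] = {V, Z} + V + ξ I` with `ξ = (1 - a)(a + N)`. -/
theorem commutator_X_V (a c : ℂ) (N : ℕ) (f : ℂ → ℂ) (x : ℂ) :
    Xop c (Vop a N f) x - Vop a N (Xop c f) x =
      Vop a N (Zop f) x + Zop (Vop a N f) x + Vop a N f x + (1 - a) * (a + N) * f x := by
  have h₁ : x - 1 + 1 = x := by ring
  have h₂ : x + 1 - 1 = x := by ring
  simp only [Vop, Xop, Zop, h₁, h₂]
  ring
end

section
/- Let a, c ∈ ℂ and N ∈ ℕ. Define the operators V, X, Z on functions f : ℂ → ℂ by (Vf)(x) = (x+a)(x+1−a−N)·f(x+1) − x(x+1)·f(x), (Xf)(x) = x·f(x−1) − (x+c)·f(x), and (Zf)(x) = −f(x−1). Then the Casimir operator Q = Z∘V∘Z + V∘Z + X∘X − (1−(2c+N))·X + (1−a)(a+N)·Z acts as the scalar (a−c)(a+c+N−1): for every f : ℂ → ℂ and x ∈ ℂ, (Z(V(Zf)))(x) + (V(Zf))(x) + (X(Xf))(x) − (1−2c−N)·(Xf)(x) + (1−a)(a+N)·(Zf)(x) = (a−c)(a+c+N−1)·f(x). -/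
/-- The Casimir element `Q = ZVZ + VZ + X² - (1 - η) X + ξ Z` acts as the scalar
`(a - c)(a + c + N - 1)` in the Hahn realization. -/
theorem casimir_meta_Hahn (a c : ℂ) (N : ℕ) (f : ℂ → ℂ) (x : ℂ) :
    Zop (Vop a N (Zop f)) x + Vop a N (Zop f) x + Xop c (Xop c f) x
      - (1 - 2 * c - N) * Xop c f x + (1 - a) * (a + N) * Zop f x
      = (a - c) * (a + c + N - 1) * f x := by
  simp only [Vop, Xop, Zop, sub_add_cancel, add_sub_cancel_right]
  ring
end

section
/- Let a, c ∈ ℂ and N ∈ ℕ. Define the operators V and Ṽ on functions f : ℂ → ℂ by (Vf)(x) = (x+a)(x+1−a−N)·f(x+1) − x(x+1)·f(x) and (Ṽf)(x) = (x+c)·f(x+1) − x·f(x). Then for every f : ℂ → ℂ and x ∈ ℂ, (V(Ṽf))(x) − (Ṽ(Vf))(x) = −(Ṽ(Ṽf))(x) − (Vf)(x) + (Ṽf)(x) + (c−a)(a+c+N−1)·f(x+2); that is, [V,Ṽ] = −Ṽ² − V + Ṽ + ζ·Z⁻² with ζ = (c−a)(a+c+N−1), where (Z⁻²f)(x) = f(x+2).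 -/
/-- The difference operator `Ṽ` of the Hahn realization. -/
noncomputable def Vtop (c : ℂ) (f : ℂ → ℂ) : ℂ → ℂ :=
  fun x => (x + c) * f (x + 1) - x * f x

/-- `[V, Ṽ] = -Ṽ² - V + Ṽ + ζ Z⁻²` with `ζ = (c - a)(a + c + N - 1)`,
where `(Z⁻² f)(x) = f (x + 2)`. -/
theorem commutator_V_Vt (a c : ℂ) (N : ℕ) (f : ℂ → ℂ) (x : ℂ) :
    Vop a N (Vtop c f) x - Vtop c (Vop a N f) x =
      -Vtop c (Vtop c f) x - Vop a N f x + Vtop c f x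
        + (c - a) * (a + c + N - 1) * f (x + 2) := by
  have h : x + 1 + 1 = x + 2 := by ring
  simp only [Vop, Vtop, h]
  ring
end

section
/- Let a, c ∈ ℂ and N ∈ ℕ. Define the operators V, Ṽ, Z, Z⁻¹ on functions f : ℂ → ℂ by (Vf)(x) = (x+a)(x+1−a−N)·f(x+1) − x(x+1)·f(x), (Ṽf)(x) = (x+c)·f(x+1) − x·f(x), (Zf)(x) = −f(x−1), (Z⁻¹f)(x) = −f(x+1). Then the Casimir element C = Z∘V + V + ζ·Z⁻¹ + Ṽ∘Z∘Ṽ + (η−1)·Ṽ, with ζ = (c−a)(a+c+N−1) and η = 2c+N, acts as the scalar (a−1)(a+N): for every f : ℂ → ℂ and x ∈ ℂ, (Z(Vf))(x) + (Vf)(x) + ζ·(Z⁻¹f)(x) + (Ṽ(Z(Ṽf)))(x) + (η−1)·(Ṽf)(x) = (a−1)(a+N)·f(x). -/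
/-- The inverse operator `Z⁻¹` of the Hahn realization. -/
noncomputable def Zinv (f : ℂ → ℂ) : ℂ → ℂ :=
  fun x => -f (x + 1)

/-- The Casimir element `C = ZV + V + ζ Z⁻¹ + Ṽ Z Ṽ + (η - 1) Ṽ` of the trio Hahn algebra,
with `ζ = (c - a)(a + c + N - 1)` and `η = 2c + N`, acts as the scalar `(a - 1)(a + N)`. -/
theorem casimir_trio_Hahn (a c : ℂ) (N : ℕ) (f : ℂ → ℂ) (x : ℂ) :
    Zop (Vop a N f) x + Vop a N f x + (c - a) * (a + c + N - 1) * Zinv f x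
      + Vtop c (Zop (Vtop c f)) x + (2 * c + N - 1) * Vtop c f x
      = (a - 1) * (a + N) * f x := by
  have h₁ : x - 1 + 1 = x := by ring
  have h₂ : x + 1 - 1 = x := by ring
  simp only [Zop, Vop, Zinv, Vtop, h₁, h₂]
  ring
end

section
/- Let a ∈ ℂ and N ∈ ℕ, and define (Vf)(x) = (x+a)(x+1−a−N)·f(x+1) − x(x+1)·f(x) for functions f : ℂ → ℂ. For 0 ≤ n ≤ N define aₙ : ℂ → ℂ by aₙ(x) = (x+a)ₙ·(x+1−a−N)_{N−n}, where (z)ₖ denotes the Pochhammer symbol (z)ₖ = z(z+1)⋯(z+k−1). Then V aₙ = (1−a−n)(a+n)·aₙ, i.e., for all x ∈ ℂ, (x+a)(x+1−a−N)·aₙ(x+1) − x(x+1)·aₙ(x) = (1−a−n)(a+n)·aₙ(x). -/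
/-- The Pochhammer symbol `(z)ₖ = z (z+1) ⋯ (z+k-1)`. -/
noncomputable def poch (z : ℂ) (k : ℕ) : ℂ := ∏ i ∈ Finset.range k, (z + i)

/-- The eigenbasis `aₙ(x) = (x+a)ₙ (x+1-a-N)_{N-n}` of the operator `V`. -/
noncomputable def aFun (a : ℂ) (N n : ℕ) (x : ℂ) : ℂ :=
  poch (x + a) n * poch (x + 1 - a - N) (N - n)

/-- Shifting the argument of the Pochhammer symbol: `z (z+1)ₖ = (z+k) (z)ₖ`. -/
theorem mul_poch_add_one (z : ℂ) (k : ℕ) : z * poch (z + 1) k = (z + k) * poch z k := by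
  induction k with
  | zero => simp [poch]
  | succ k ih =>
    simp only [poch, Finset.prod_range_succ] at ih ⊢
    push_cast
    linear_combination (z + 1 + k) * ih

/-- `V aₙ = (1 - a - n)(a + n) aₙ` for `0 ≤ n ≤ N`. -/
theorem V_eigen (a : ℂ) (N n : ℕ) (hn : n ≤ N) (x : ℂ) :
    Vop a N (aFun a N n) x = (1 - a - n) * (a + n) * aFun a N n x := by
  have h₁ := mul_poch_add_one (x + a) n
  have h₂ := mul_poch_add_one (x + 1 - a - N) (N - n)
  rw [Nat.cast_sub hn] at h₂
  have e₁ : x + 1 + a = x + a + 1 := by ring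
  have e₂ : x + 1 + 1 - a - N = x + 1 - a - N + 1 := by ring
  simp only [Vop, aFun, e₁, e₂]
  linear_combination (x + 1 - a - N) * poch (x + 1 - a - N + 1) (N - n) * h₁ +
    (x + a + n) * poch (x + a) n * h₂
end

section
/- Let a, ρ ∈ ℂ and N ∈ ℕ, and define (K₁f)(x) = (x−ρ)·(f(x−1) − f(x)) + ((N−ρ)/2)·f(x) for functions f : ℂ → ℂ. For n ∈ ℕ define sₙ : ℂ → ℂ by sₙ(x) = (x+a)ₙ, where (z)ₖ denotes the Pochhammer symbol. Then K₁ acts bidiagonally on this basis: for every n ≥ 1 and all x ∈ ℂ, (K₁sₙ)(x) = ((N−ρ)/2 − n)·sₙ(x) + n·(n−1+a+ρ)·s_{n−1}(x), and (K₁s₀)(x) = ((N−ρ)/2)·s₀(x). -/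
/-- The split basis `sₙ(x) = (x+a)ₙ`. -/
noncomputable def sFun (a : ℂ) (n : ℕ) (x : ℂ) : ℂ := poch (x + a) n

/-- The difference operator `K₁`. -/
noncomputable def K1op (ρ : ℂ) (N : ℕ) (f : ℂ → ℂ) : ℂ → ℂ :=
  fun x => (x - ρ) * (f (x - 1) - f x) + ((N - ρ) / 2) * f x

theorem poch_succ (z : ℂ) (k : ℕ) : poch z (k + 1) = poch z k * (z + k) :=
  Finset.prod_range_succ _ _

theorem poch_sub_one_succ (z : ℂ) (k : ℕ) : poch (z - 1) (k + 1) = (z - 1) * poch z k := by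
  rw [poch, Finset.prod_range_succ', mul_comm, poch]
  congr 1
  · simp
  · refine Finset.prod_congr rfl fun i _ => ?_
    push_cast
    ring

/-- `K₁` acts bidiagonally on the split basis:
`K₁ sₙ = ((N-ρ)/2 - n) sₙ + n (n - 1 + a + ρ) s_{n-1}` for `n ≥ 1`,
and `K₁ s₀ = ((N-ρ)/2) s₀`. -/
theorem K1_bidiagonal (a ρ : ℂ) (N : ℕ) :
    (∀ n : ℕ, 1 ≤ n → ∀ x : ℂ,
      K1op ρ N (sFun a n) x =
        ((N - ρ) / 2 - n) * sFun a n x + n * (n - 1 + a + ρ) * sFun a (n - 1) x) ∧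
    (∀ x : ℂ, K1op ρ N (sFun a 0) x = ((N - ρ) / 2) * sFun a 0 x) := by
  refine ⟨fun n hn x => ?_, fun x => by simp [K1op, sFun, poch]⟩
  obtain ⟨m, rfl⟩ := Nat.exists_eq_add_of_le' hn
  simp only [K1op, sFun, Nat.add_sub_cancel]
  rw [sub_add_eq_add_sub, poch_sub_one_succ, poch_succ]
  push_cast
  ring
end
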